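/- Conservation laws for the Dirac currents: let Γ₀,Γ₁,Γ₂,Γ₃ : ℝ⁴ → ℝ be smooth, Γ := Σ_μ Γ_μ e^μ, and let φ : ℝ⁴ → M₂(ℂ) be smooth and satisfy the nonlinear Dirac equation Σ_{μ=0}^{3} e^μ·∂_μφ̂ + i·Γ·φ̂·e₃ = 0 on ℝ⁴. Define the currents D_κ := φ·e_κ·φ† with contravariant components D_κ^0 := ½tr(D_κ), D_κ^k := ½tr(D_κ·e_k). Then on ℝ⁴: Σ_μ ∂_μ D_0^μ = 0, Σ_μ ∂_μ D_3^μ = 0, Σ_μ ∂_μ D_1^μ = 2·Σ_μ Γ_μ·D_2^μ, and Σ_μ ∂_μ D_2^μ = -2·Σ_μ Γ_μ·D_1^μ (all sums over μ = 0,…,3). -/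

import Mathlib

open Matrix

noncomputable section

/-- The space algebra `Cl(3)` represented as `M₂(ℂ)`. -/
abbrev M2 : Type := Matrix (Fin 2) (Fin 2) ℂ

/-- Spacetime `ℝ⁴`. -/
abbrev R4 : Type := Fin 4 → ℝ

/-- Basis paravectors: `e 0 = 1` and the Pauli matrices. -/
def e : Fin 4 → M2 :=
  ![1, !![0, 1; 1, 0], !![0, -Complex.I; Complex.I, 0], !![1, 0; 0, -1]]

/-- Dual basis paravectors: `edual 0 = 1` and `edual k = - e k` for `k = 1,2,3`. -/
def edual : Fin 4 → M2 :=
  ![1, -e 1, -e 2, -e 3]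

/-- The grade automorphism `M̂ = (adj M)†`. -/
def gradeAut (M : M2) : M2 := (M.adjugate)ᴴ

/-- The projector `P = ½(1+e₃)`. -/
def P : M2 := !![1, 0; 0, 0]

/-- The projector `P̄ = ½(1-e₃)`. -/
def Pbar : M2 := !![0, 0; 0, 1]

/-- Partial derivative `∂_μ` of a complex-valued function on `ℝ⁴`. -/
def pdC (μ : Fin 4) (f : R4 → ℂ) (x : R4) : ℂ := fderiv ℝ f x (Pi.single μ 1)

/-- Partial derivative `∂_μ` of a real-valued function on `ℝ⁴`. -/
def pdR (μ : Fin 4) (f : R4 → ℝ) (x : R4) : ℝ := fderiv ℝ f x (Pi.single μ 1)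

/-- Entrywise partial derivative `∂_μ` of an `M₂(ℂ)`-valued function on `ℝ⁴`. -/
def pdM (μ : Fin 4) (f : R4 → M2) (x : R4) : M2 :=
  Matrix.of fun i j => pdC μ (fun y => f y i j) x

/-- Components of the chiral current `𝔧 = φ·P̄·φ†`: `j^μ = ½ tr(𝔧 * e μ)`
(note `e 0 = 1`). -/
def jComp (φ : R4 → M2) (μ : Fin 4) (x : R4) : ℂ :=
  (1/2) * (φ x * Pbar * (φ x)ᴴ * e μ).trace

/-- Tétrode's energy-momentum tensor `T_ν^μ`. -/
def TComp (Γ : Fin 4 → R4 → ℝ) (φ : R4 → M2) (ν μ : Fin 4) (x : R4) : ℂ :=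
  -(Complex.I / 4) *
      (edual μ *
        (pdM ν (fun y => gradeAut (φ y)) x * P * (φ x).adjugate
          - gradeAut (φ x) * P * pdM ν (fun y => (φ y).adjugate) x)).trace
    + (Γ ν x : ℂ) * jComp φ μ x

/-- The Levi-Civita symbol on `{1,2,3}` (indexed by `Fin 3`), with `ε 0 1 2 = 1`. -/
def eps : Fin 3 → Fin 3 → Fin 3 → ℝ := fun i j k =>
  if (i, j, k) = (0, 1, 2) ∨ (i, j, k) = (1, 2, 0) ∨ (i, j, k) = (2, 0, 1) then 1
  else if (i, j, k) = (2, 1, 0) ∨ (i, j, k) = (1, 0, 2) ∨ (i, j, k) = (0, 2, 1) then -1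
  else 0

/-- Contravariant components of the Dirac currents `D κ = φ·e κ·φ†`:
`D_κ^μ = ½ tr(D κ * e μ)` (note `e 0 = 1`). -/
def DComp (φ : R4 → M2) (κ μ : Fin 4) (x : R4) : ℂ :=
  (1/2) * (φ x * e κ * (φ x)ᴴ * e μ).trace

lemma pdC_eq_of_hasDerivAt (μ : Fin 4) (f : R4 → ℂ) (x : R4) (d : ℂ) (hf : DifferentiableAt ℝ f x)
    (h : HasDerivAt (fun t : ℝ => f (x + t • Pi.single μ (1 : ℝ))) d 0) : pdC μ f x = d := by
  have h1 : HasLineDerivAt ℝ f d x (Pi.single μ (1 : ℝ)) := h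
  exact (hf.hasFDerivAt.hasLineDerivAt _).unique h1

lemma hasDerivAt_pdC (μ : Fin 4) (f : R4 → ℂ) (x : R4) (hf : DifferentiableAt ℝ f x) :
    HasDerivAt (fun t : ℝ => f (x + t • Pi.single μ (1 : ℝ))) (pdC μ f x) 0 :=
  hf.hasFDerivAt.hasLineDerivAt _

lemma diff_star (f : R4 → ℂ) (x : R4) (hf : DifferentiableAt ℝ f x) :
    DifferentiableAt ℝ (fun y => star (f y)) x := hf.star

lemma pdC_star (μ : Fin 4) (f : R4 → ℂ) (x : R4) (hf : DifferentiableAt ℝ f x) :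
    pdC μ (fun y => star (f y)) x = star (pdC μ f x) :=
  pdC_eq_of_hasDerivAt _ _ _ _ hf.star (hasDerivAt_pdC μ f x hf).star

lemma pdC_neg (μ : Fin 4) (f : R4 → ℂ) (x : R4) (hf : DifferentiableAt ℝ f x) :
    pdC μ (fun y => -(f y)) x = -(pdC μ f x) :=
  pdC_eq_of_hasDerivAt _ _ _ _ hf.neg (hasDerivAt_pdC μ f x hf).neg

lemma gradeAut_eq (M : M2) :
    gradeAut M = !![star (M 1 1), -star (M 1 0); -star (M 0 1), star (M 0 0)] := by
  ext i j
  fin_cases i <;> fin_cases j <;> simp [gradeAut, Matrix.adjugate_fin_two]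

lemma pdM_gradeAut (μ : Fin 4) (φ : R4 → M2) (x : R4)
    (hφ : ∀ i j, DifferentiableAt ℝ (fun y => φ y i j) x) :
    pdM μ (fun y => gradeAut (φ y)) x = gradeAut (pdM μ φ x) := by
  rw [gradeAut_eq]
  have hs := fun i j => pdC_star μ (fun y => φ y i j) x (hφ i j)
  have hn := fun i j => pdC_neg μ (fun y => star (φ y i j)) x (hφ i j).star
  ext i j
  fin_cases i <;> fin_cases j <;> simp [pdM, gradeAut_eq] at hs hn ⊢ <;> simp [hs, hn]

lemma pdC_DComp (κ ν μ : Fin 4) (φ : R4 → M2) (x : R4)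
    (hφ : ∀ i j, DifferentiableAt ℝ (fun y => φ y i j) x) :
    pdC μ (fun y => DComp φ κ ν y) x =
      (1/2) * (pdM μ φ x * e κ * (φ x)ᴴ * e ν + φ x * e κ * (pdM μ φ x)ᴴ * e ν).trace := by
  have hs := fun i j => (hφ i j).star
  have h := fun i j => hasDerivAt_pdC μ _ x (hφ i j)
  have h' := fun i j => (h i j).star
  apply pdC_eq_of_hasDerivAt
  · simp only [DComp, Matrix.trace, Matrix.diag, Matrix.mul_apply, Matrix.conjTranspose_apply]
    fun_prop
  · simp only [DComp, Matrix.trace, Matrix.diag, Matrix.mul_apply, Matrix.conjTranspose_apply]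
    have := HasDerivAt.const_mul (1/2 : ℂ) (HasDerivAt.fun_sum (u := Finset.univ) fun i _ =>
      HasDerivAt.fun_sum (u := Finset.univ) fun j _ =>
      (HasDerivAt.fun_sum (u := Finset.univ) fun k _ =>
        (HasDerivAt.fun_sum (u := Finset.univ) fun l _ =>
          (h i l).mul_const (e κ l k)).fun_mul (h' j k)).mul_const (e ν j i))
    refine this.congr_deriv ?_
    simp [Fin.sum_univ_two, pdM, Matrix.mul_apply]
    ring

lemma key (g : Fin 4 → ℂ) (hg : ∀ μ, star (g μ) = g μ) (a : M2) (d : Fin 4 → M2)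
    (h : (∑ μ : Fin 4, edual μ * gradeAut (d μ))
        + Complex.I • ((∑ μ : Fin 4, g μ • edual μ) * gradeAut a * e 3) = 0) :
    (∑ μ : Fin 4, e μ * d μ) = - Complex.I • ((∑ μ : Fin 4, g μ • e μ) * a * e 3) := by
  have h00 := congrArg star (congrFun (congrFun h 0) 0)
  have h01 := congrArg star (congrFun (congrFun h 0) 1)
  have h10 := congrArg star (congrFun (congrFun h 1) 0)
  have h11 := congrArg star (congrFun (congrFun h 1) 1)
  simp only [Complex.star_def] at hg
  simp [gradeAut_eq, Fin.sum_univ_four, e, edual, Matrix.mul_apply, hg] at h00 h01 h10 h11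
  ext i j
  fin_cases i <;> fin_cases j <;>
    simp [Fin.sum_univ_four, e, Matrix.mul_apply, Matrix.vecMul, dotProduct]
  · linear_combination h11
  · linear_combination -h10
  · linear_combination -h01
  · linear_combination h00

lemma e_herm (μ : Fin 4) : (e μ)ᴴ = e μ := by
  ext i j
  fin_cases μ <;> fin_cases i <;> fin_cases j <;> simp [e]

lemma main_id (g : Fin 4 → ℂ) (hg : ∀ μ, star (g μ) = g μ) (a : M2) (d : Fin 4 → M2)
    (h : (∑ μ : Fin 4, e μ * d μ) = - Complex.I • ((∑ μ : Fin 4, g μ • e μ) * a * e 3))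
    (κ : Fin 4) :
    ∑ μ : Fin 4, (1/2) * (d μ * e κ * aᴴ * e μ + a * e κ * (d μ)ᴴ * e μ).trace
      = ∑ μ : Fin 4, g μ * ((1/2) *
        (a * (Complex.I • (e κ * e 3 - e 3 * e κ)) * aᴴ * e μ).trace) := by
  have h2 := congrArg conjTranspose h
  simp only [conjTranspose_sum, conjTranspose_mul, conjTranspose_smul, e_herm, hg] at h2
  have t1 := congrArg (fun M : M2 => (M * (e κ * aᴴ)).trace) h
  have t2 := congrArg (fun M : M2 => (a * e κ * M).trace) h2
  simp only [Finset.sum_mul, Finset.mul_sum, Finset.smul_sum, trace_sum, smul_mul_assoc,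
    mul_smul_comm, trace_smul, star_neg, Complex.star_def, Complex.conj_I, smul_eq_mul] at t1 t2
  have c1 : ∀ μ, (d μ * e κ * aᴴ * e μ).trace = (e μ * d μ * (e κ * aᴴ)).trace := fun μ => by
    rw [trace_mul_comm]; simp only [mul_assoc]
  have c2 : ∀ μ, (a * e κ * (d μ)ᴴ * e μ).trace = (a * e κ * ((d μ)ᴴ * e μ)).trace := fun μ => by
    simp only [mul_assoc]
  have c3 : ∀ μ, (a * (e 3 * e κ) * aᴴ * e μ).trace = (e μ * a * e 3 * (e κ * aᴴ)).trace :=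
    fun μ => by rw [trace_mul_comm]; simp only [mul_assoc]
  have c4 : ∀ μ, (a * (e κ * e 3) * aᴴ * e μ).trace = (a * e κ * (e 3 * (aᴴ * e μ))).trace :=
    fun μ => by simp only [mul_assoc]
  simp only [trace_add, c1, c2, mul_smul_comm, smul_mul_assoc, trace_smul, mul_sub, sub_mul,
    trace_sub, smul_sub, c3, c4, smul_eq_mul]
  simp only [Fin.sum_univ_four] at t1 t2 ⊢
  linear_combination (1/2) * t1 + (1/2) * t2

/-- Conservation laws for the Dirac currents of the nonlinear Dirac equation. -/
theorem dirac_currents_conservation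
    (Γ : Fin 4 → R4 → ℝ) (hΓ : ∀ μ, ContDiff ℝ (⊤ : ℕ∞) (Γ μ))
    (φ : R4 → M2) (hφ : ∀ i j, ContDiff ℝ (⊤ : ℕ∞) (fun x => φ x i j))
    (hDirac : ∀ x : R4,
      (∑ μ : Fin 4, edual μ * pdM μ (fun y => gradeAut (φ y)) x)
        + Complex.I • ((∑ μ : Fin 4, (Γ μ x : ℂ) • edual μ) * gradeAut (φ x) * e 3) = 0) :
    ∀ x : R4,
      (∑ μ : Fin 4, pdC μ (fun y => DComp φ 0 μ y) x = 0) ∧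
      (∑ μ : Fin 4, pdC μ (fun y => DComp φ 3 μ y) x = 0) ∧
      (∑ μ : Fin 4, pdC μ (fun y => DComp φ 1 μ y) x
        = 2 * ∑ μ : Fin 4, (Γ μ x : ℂ) * DComp φ 2 μ x) ∧
      (∑ μ : Fin 4, pdC μ (fun y => DComp φ 2 μ y) x
        = -2 * ∑ μ : Fin 4, (Γ μ x : ℂ) * DComp φ 1 μ x) := by
  intro x
  have hd : ∀ i j, DifferentiableAt ℝ (fun y => φ y i j) x := fun i j =>
    ((hφ i j).differentiable (by simp)).differentiableAt
  have h := hDirac x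
  simp only [fun μ => pdM_gradeAut μ φ x hd] at h
  have hg : ∀ μ, star ((Γ μ x : ℂ)) = (Γ μ x : ℂ) := fun μ => Complex.conj_ofReal _
  have hk := main_id (fun μ => (Γ μ x : ℂ)) hg (φ x) (fun μ => pdM μ φ x)
    (key (fun μ => (Γ μ x : ℂ)) hg _ _ h)
  have e0 : Complex.I • (e 0 * e 3 - e 3 * e 0) = 0 := by simp [e]
  have e1 : Complex.I • (e 1 * e 3 - e 3 * e 1) = (2 : ℂ) • e 2 := by
    ext i j
    fin_cases i <;> fin_cases j <;> simp [e] <;> ring_nf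
  have e2 : Complex.I • (e 2 * e 3 - e 3 * e 2) = (-2 : ℂ) • e 1 := by
    ext i j
    fin_cases i <;> fin_cases j <;> simp [e] <;> ring_nf <;> simp
  simp only [fun κ ν μ => pdC_DComp κ ν μ φ x hd, hk, e0, e1, e2, sub_self]
  refine ⟨by simp, by simp, ?_, ?_⟩
  · simp only [DComp, Finset.mul_sum, mul_smul_comm, smul_mul_assoc, trace_smul, smul_eq_mul]
    exact Finset.sum_congr rfl fun μ _ => by ring
  · simp only [DComp, Finset.mul_sum, mul_smul_comm, smul_mul_assoc, trace_smul, smul_eq_mul]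
    exact Finset.sum_congr rfl fun μ _ => by ring
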